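/- The 7-dimensional nilpotent Lie algebra 𝔤 = (0,0,0,0,12,15,0) admits no 4-form φ that is both closed (dφ = 0) and stable with definite associated bilinear form b_φ-dual; i.e. 𝔤 admits no cocalibrated G2-structure. -/

import Mathlib

/- STATEMENT 12: The 7-dimensional nilpotent Lie algebra 𝔤 = (0,0,0,0,12,15,0) admits
no cocalibrated G2-structure: there is no 4-form φ on 𝔤 which is closed and stable
with definite associated form.  A 4-form is stable-definite (equivalently, dual of a
G2-structure) iff it lies in the GL(7,ℝ)-orbit of the standard positive 4-form
Φ₀ = f¹²³⁴+f¹²⁵⁶+f³⁴⁵⁶+f²⁴⁶⁷−f¹³⁶⁷−f¹⁴⁵⁷−f²³⁵⁷.  (0-based indices below.) -/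

noncomputable section

open ExteriorAlgebra

abbrev W7 : Type := Fin 7 → ℝ

/-- the basis covectors e¹,…,e⁷ (0-based) -/
def ev (i : Fin 7) : ExteriorAlgebra ℝ W7 := ExteriorAlgebra.ι ℝ (Pi.single i 1)

/-- the differentials de¹,…,de⁷ of the Lie algebra (0,0,0,0,12,15,0) -/
def d1 : Fin 7 → ExteriorAlgebra ℝ W7 :=
  ![0, 0, 0, 0, ev 0 * ev 1, ev 0 * ev 4, 0]

/-- the 4-form with coefficients `c` -/
def phi4 (c : Fin 7 → Fin 7 → Fin 7 → Fin 7 → ℝ) : ExteriorAlgebra ℝ W7 :=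
  ∑ i : Fin 7, ∑ j : Fin 7, ∑ k : Fin 7, ∑ l : Fin 7,
    if i < j ∧ j < k ∧ k < l then c i j k l • (ev i * ev j * ev k * ev l) else 0

/-- the Chevalley–Eilenberg differential of the 4-form with coefficients `c`
(extension of d1 as an antiderivation) -/
def dPhi4 (c : Fin 7 → Fin 7 → Fin 7 → Fin 7 → ℝ) : ExteriorAlgebra ℝ W7 :=
  ∑ i : Fin 7, ∑ j : Fin 7, ∑ k : Fin 7, ∑ l : Fin 7,
    if i < j ∧ j < k ∧ k < l then
      c i j k l • (d1 i * ev j * ev k * ev l - ev i * d1 j * ev k * ev l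
        + ev i * ev j * d1 k * ev l - ev i * ev j * ev k * d1 l)
    else 0

/-- the standard positive (G2) 4-form (0-based indices) -/
def Phi0 : ExteriorAlgebra ℝ W7 :=
  ev 0 * ev 1 * ev 2 * ev 3 + ev 0 * ev 1 * ev 4 * ev 5 + ev 2 * ev 3 * ev 4 * ev 5
    + ev 1 * ev 3 * ev 5 * ev 6 - ev 0 * ev 2 * ev 5 * ev 6
    - ev 0 * ev 3 * ev 4 * ev 6 - ev 1 * ev 2 * ev 4 * ev 6

/-- contraction with the `i`-th dual basis vector -/
def K (i : Fin 7) : ExteriorAlgebra ℝ W7 →ₗ[ℝ] ExteriorAlgebra ℝ W7 :=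
  CliffordAlgebra.contractLeft (Q := (0 : QuadraticForm ℝ W7)) (LinearMap.proj i)

theorem K_ι_mul (i : Fin 7) (a : W7) (x : ExteriorAlgebra ℝ W7) :
    K i (ι ℝ a * x) = a i • x - ι ℝ a * K i x :=
  CliffordAlgebra.contractLeft_ι_mul _ _ _

theorem K_ι (i : Fin 7) (a : W7) : K i (ι ℝ a) = a i • 1 := by
  rw [← Algebra.algebraMap_eq_smul_one]
  exact CliffordAlgebra.contractLeft_ι _ _ _

theorem K_one (i : Fin 7) : K i 1 = 0 :=
  CliffordAlgebra.contractLeft_one _ _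

theorem K_ev_mul_self (i : Fin 7) (x : ExteriorAlgebra ℝ W7) :
    K i (ev i * x) = x - ev i * K i x := by
  simp [ev, K_ι_mul]

theorem K_ev_mul_ne (i j : Fin 7) (h : i ≠ j) (x : ExteriorAlgebra ℝ W7) :
    K i (ev j * x) = - (ev j * K i x) := by
  simp [ev, K_ι_mul, h]

theorem K_ev_self (i : Fin 7) : K i (ev i) = 1 := by
  simp [ev, K_ι]

theorem K_ev_ne (i j : Fin 7) (h : i ≠ j) : K i (ev j) = 0 := by
  simp [ev, K_ι, h]

theorem sum4 {M : Type*} [AddCommMonoid M] (F : Fin 7 → Fin 7 → Fin 7 → Fin 7 → M) :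
    (∑ i : Fin 7, ∑ j : Fin 7, ∑ k : Fin 7, ∑ l : Fin 7,
      if i < j ∧ j < k ∧ k < l then F i j k l else 0) =
    F 0 1 2 3 + F 0 1 2 4 + F 0 1 2 5 + F 0 1 2 6 + F 0 1 3 4
      + F 0 1 3 5 + F 0 1 3 6 + F 0 1 4 5 + F 0 1 4 6 + F 0 1 5 6
      + F 0 2 3 4 + F 0 2 3 5 + F 0 2 3 6 + F 0 2 4 5 + F 0 2 4 6
      + F 0 2 5 6 + F 0 3 4 5 + F 0 3 4 6 + F 0 3 5 6 + F 0 4 5 6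
      + F 1 2 3 4 + F 1 2 3 5 + F 1 2 3 6 + F 1 2 4 5 + F 1 2 4 6
      + F 1 2 5 6 + F 1 3 4 5 + F 1 3 4 6 + F 1 3 5 6 + F 1 4 5 6
      + F 2 3 4 5 + F 2 3 4 6 + F 2 3 5 6 + F 2 4 5 6 + F 3 4 5 6 := by
  simp [Fin.sum_univ_seven, add_assoc]

theorem cross_0 (u v : W7) (h : ι ℝ u * (ι ℝ v * Phi0) = 0) :
    (u 1 * v 6 - u 6 * v 1) - (u 2 * v 4 - u 4 * v 2) + (u 3 * v 5 - u 5 * v 3) = 0 := by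
  simp only [Phi0, mul_add, mul_sub, mul_assoc] at h
  have h0 := congrArg (fun x => algebraMapInv (K 6 (K 5 (K 4 (K 3 (K 2 (K 1 x))))))) h
  simp [K_ι_mul, K_ι, K_ev_mul_self, K_ev_mul_ne, K_ev_self, K_ev_ne] at h0
  first
  | linear_combination h0
  | linear_combination - h0

theorem cross_1 (u v : W7) (h : ι ℝ u * (ι ℝ v * Phi0) = 0) :
    -(u 0 * v 6 - u 6 * v 0) + (u 2 * v 5 - u 5 * v 2) + (u 3 * v 4 - u 4 * v 3) = 0 := by
  simp only [Phi0, mul_add, mul_sub, mul_assoc] at h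
  have h0 := congrArg (fun x => algebraMapInv (K 6 (K 5 (K 4 (K 3 (K 2 (K 0 x))))))) h
  simp [K_ι_mul, K_ι, K_ev_mul_self, K_ev_mul_ne, K_ev_self, K_ev_ne] at h0
  first
  | linear_combination h0
  | linear_combination - h0

theorem cross_2 (u v : W7) (h : ι ℝ u * (ι ℝ v * Phi0) = 0) :
    (u 3 * v 6 - u 6 * v 3) + (u 0 * v 4 - u 4 * v 0) - (u 1 * v 5 - u 5 * v 1) = 0 := by
  simp only [Phi0, mul_add, mul_sub, mul_assoc] at h
  have h0 := congrArg (fun x => algebraMapInv (K 6 (K 5 (K 4 (K 3 (K 1 (K 0 x))))))) h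
  simp [K_ι_mul, K_ι, K_ev_mul_self, K_ev_mul_ne, K_ev_self, K_ev_ne] at h0
  first
  | linear_combination h0
  | linear_combination - h0

theorem cross_3 (u v : W7) (h : ι ℝ u * (ι ℝ v * Phi0) = 0) :
    -(u 2 * v 6 - u 6 * v 2) - (u 0 * v 5 - u 5 * v 0) - (u 1 * v 4 - u 4 * v 1) = 0 := by
  simp only [Phi0, mul_add, mul_sub, mul_assoc] at h
  have h0 := congrArg (fun x => algebraMapInv (K 6 (K 5 (K 4 (K 2 (K 1 (K 0 x))))))) h
  simp [K_ι_mul, K_ι, K_ev_mul_self, K_ev_mul_ne, K_ev_self, K_ev_ne] at h0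
  first
  | linear_combination h0
  | linear_combination - h0

theorem cross_4 (u v : W7) (h : ι ℝ u * (ι ℝ v * Phi0) = 0) :
    (u 5 * v 6 - u 6 * v 5) - (u 0 * v 2 - u 2 * v 0) + (u 1 * v 3 - u 3 * v 1) = 0 := by
  simp only [Phi0, mul_add, mul_sub, mul_assoc] at h
  have h0 := congrArg (fun x => algebraMapInv (K 6 (K 5 (K 3 (K 2 (K 1 (K 0 x))))))) h
  simp [K_ι_mul, K_ι, K_ev_mul_self, K_ev_mul_ne, K_ev_self, K_ev_ne] at h0
  first
  | linear_combination h0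
  | linear_combination - h0

theorem cross_5 (u v : W7) (h : ι ℝ u * (ι ℝ v * Phi0) = 0) :
    -(u 4 * v 6 - u 6 * v 4) + (u 0 * v 3 - u 3 * v 0) + (u 1 * v 2 - u 2 * v 1) = 0 := by
  simp only [Phi0, mul_add, mul_sub, mul_assoc] at h
  have h0 := congrArg (fun x => algebraMapInv (K 6 (K 4 (K 3 (K 2 (K 1 (K 0 x))))))) h
  simp [K_ι_mul, K_ι, K_ev_mul_self, K_ev_mul_ne, K_ev_self, K_ev_ne] at h0
  first
  | linear_combination h0
  | linear_combination - h0

theorem cross_6 (u v : W7) (h : ι ℝ u * (ι ℝ v * Phi0) = 0) :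
    (u 0 * v 1 - u 1 * v 0) + (u 2 * v 3 - u 3 * v 2) + (u 4 * v 5 - u 5 * v 4) = 0 := by
  simp only [Phi0, mul_add, mul_sub, mul_assoc] at h
  have h0 := congrArg (fun x => algebraMapInv (K 5 (K 4 (K 3 (K 2 (K 1 (K 0 x))))))) h
  simp [K_ι_mul, K_ι, K_ev_mul_self, K_ev_mul_ne, K_ev_self, K_ev_ne] at h0
  first
  | linear_combination h0
  | linear_combination - h0

theorem minors_zero (u v : W7) (h : ι ℝ u * (ι ℝ v * Phi0) = 0) (i j : Fin 7) :
    u i * v j - u j * v i = 0 := by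
  have key : ∑ i : Fin 7, ∑ j : Fin 7, (u i * v j - u j * v i) ^ 2 = 0 := by
    simp only [Fin.sum_univ_seven]
    linear_combination
      2 * ((u 1 * v 6 - u 6 * v 1) - (u 2 * v 4 - u 4 * v 2) + (u 3 * v 5 - u 5 * v 3)) * cross_0 u v h +
      2 * (-(u 0 * v 6 - u 6 * v 0) + (u 2 * v 5 - u 5 * v 2) + (u 3 * v 4 - u 4 * v 3)) * cross_1 u v h +
      2 * ((u 3 * v 6 - u 6 * v 3) + (u 0 * v 4 - u 4 * v 0) - (u 1 * v 5 - u 5 * v 1)) * cross_2 u v h +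
      2 * (-(u 2 * v 6 - u 6 * v 2) - (u 0 * v 5 - u 5 * v 0) - (u 1 * v 4 - u 4 * v 1)) * cross_3 u v h +
      2 * ((u 5 * v 6 - u 6 * v 5) - (u 0 * v 2 - u 2 * v 0) + (u 1 * v 3 - u 3 * v 1)) * cross_4 u v h +
      2 * (-(u 4 * v 6 - u 6 * v 4) + (u 0 * v 3 - u 3 * v 0) + (u 1 * v 2 - u 2 * v 1)) * cross_5 u v h +
      2 * ((u 0 * v 1 - u 1 * v 0) + (u 2 * v 3 - u 3 * v 2) + (u 4 * v 5 - u 5 * v 4)) * cross_6 u v h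
  have h1 := (Finset.sum_eq_zero_iff_of_nonneg
    (fun i _ => Finset.sum_nonneg fun j _ => sq_nonneg _)).1 key i (Finset.mem_univ i)
  have h2 := (Finset.sum_eq_zero_iff_of_nonneg
    (fun j _ => sq_nonneg _)).1 h1 j (Finset.mem_univ j)
  exact pow_eq_zero_iff (two_ne_zero) |>.1 h2

theorem ev_mul_ev_mul (i : Fin 7) (x : ExteriorAlgebra ℝ W7) : ev i * (ev i * x) = 0 := by
  rw [← mul_assoc, ev, ι_sq_zero, zero_mul]

theorem ev_mul_mul (i j : Fin 7) (x : ExteriorAlgebra ℝ W7) :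
    ev i * (ev j * (ev i * x)) = 0 := by
  have h : ev i * ev j = - (ev j * ev i) :=
    eq_neg_of_add_eq_zero_left (ι_add_mul_swap _ _)
  rw [← mul_assoc, h, neg_mul, mul_assoc, ev_mul_ev_mul, mul_zero, neg_zero]

theorem closed_coefs (c : Fin 7 → Fin 7 → Fin 7 → Fin 7 → ℝ) (h : dPhi4 c = 0) :
    c 2 3 4 5 = 0 ∧ c 2 3 4 6 = 0 ∧ c 2 3 5 6 = 0 ∧ c 2 4 5 6 = 0 ∧ c 3 4 5 6 = 0 := by
  rw [dPhi4, sum4] at h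
  simp [d1, mul_assoc] at h
  refine ⟨?_, ?_, ?_, ?_, ?_⟩
  · have h0 := congrArg (fun x => algebraMapInv (K 5 (K 3 (K 2 (K 1 (K 0 x)))))) h
    simpa [K_ev_mul_self, K_ev_mul_ne, K_ev_self, K_ev_ne] using h0
  · have h0 := congrArg (fun x => algebraMapInv (K 6 (K 3 (K 2 (K 1 (K 0 x)))))) h
    simpa [K_ev_mul_self, K_ev_mul_ne, K_ev_self, K_ev_ne] using h0
  · have h0 := congrArg (fun x => algebraMapInv (K 6 (K 4 (K 3 (K 2 (K 0 x)))))) h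
    simpa [K_ev_mul_self, K_ev_mul_ne, K_ev_self, K_ev_ne] using h0
  · have h0 := congrArg (fun x => algebraMapInv (K 6 (K 5 (K 2 (K 1 (K 0 x)))))) h
    simpa [K_ev_mul_self, K_ev_mul_ne, K_ev_self, K_ev_ne] using h0
  · have h0 := congrArg (fun x => algebraMapInv (K 6 (K 5 (K 3 (K 1 (K 0 x)))))) h
    simpa [K_ev_mul_self, K_ev_mul_ne, K_ev_self, K_ev_ne] using h0

theorem wedge_phi (c : Fin 7 → Fin 7 → Fin 7 → Fin 7 → ℝ) (h : dPhi4 c = 0) :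
    ev 0 * (ev 1 * phi4 c) = 0 := by
  obtain ⟨h1, h2, h3, h4, h5⟩ := closed_coefs c h
  rw [phi4, sum4]
  simp [h1, h2, h3, h4, h5, mul_add, mul_assoc, ev_mul_ev_mul, ev_mul_mul]

theorem no_cocalibrated_G2_structure :
    ¬ ∃ c : Fin 7 → Fin 7 → Fin 7 → Fin 7 → ℝ,
        dPhi4 c = 0 ∧
        ∃ g : W7 ≃ₗ[ℝ] W7, phi4 c = ExteriorAlgebra.map (g : W7 →ₗ[ℝ] W7) Phi0 := by
  rintro ⟨c, hc, g, hg⟩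
  have h := wedge_phi c hc
  rw [hg] at h
  have h' := congrArg (ExteriorAlgebra.map (g.symm : W7 →ₗ[ℝ] W7)) h
  have hcomp : ∀ x, ExteriorAlgebra.map (g.symm : W7 →ₗ[ℝ] W7)
      (ExteriorAlgebra.map (g : W7 →ₗ[ℝ] W7) x) = x := by
    intro x
    rw [← AlgHom.comp_apply, ExteriorAlgebra.map_comp_map]
    simp
  simp only [map_mul, hcomp, map_zero, ev, ExteriorAlgebra.map_apply_ι] at h'
  have hm := minors_zero _ _ h'
  simp only [LinearEquiv.coe_coe] at hm
  set u := g.symm (Pi.single 0 1) with hu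
  set v := g.symm (Pi.single 1 1) with hv
  have hgu : g u = Pi.single 0 1 := by simp [hu]
  have hgv : g v = Pi.single 1 1 := by simp [hv]
  have hall : ∀ i, u i = 0 := by
    intro i
    have e : u i • v = v i • u := by
      ext j
      simp only [Pi.smul_apply, smul_eq_mul]
      linear_combination hm i j
    have e2 := congrFun (congrArg g e) 1
    simpa [hgu, hgv] using e2
  have hu0 : u = 0 := funext hall
  have e3 := congrFun hgu 0
  simp [hu0] at e3

end
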